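/- Let B ⊆ ℝ² be open and let T be a smooth symmetric (²₀)-tensor field on B (T^{IJ} = T^{JI}). Then there exists a smooth vector field Y : B → ℝ² with T = grad^s Y, i.e. T^{IJ} = (∂_J Y^I + ∂_I Y^J)/2 on B for all I, J, if and only if all of the following hold: (i) D_c T = 0 on B, i.e. ∂_2∂_2 T^{11} − 2 ∂_1∂_2 T^{12} + ∂_1∂_1 T^{22} = 0 on B; (ii) for every smooth closed curve γ in B and every I ∈ {1,2}, ∫₀¹ Σ_{J} [ T^{IJ}(γ(t)) − Σ_{K} γ^K(t) ( ∂_K T^{IJ} − ∂_I T^{JK} )(γ(t)) ] γ′^J(t) dt = 0; and (iii) for every smooth closed curve γ in B and all I, J ∈ {1,2}, ∫₀¹ Σ_{K} ( ∂_J T^{IK} − ∂_I T^{JK} )(γ(t)) γ′^K(t) dt = 0. -/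

import Mathlib

/-- Partial derivative in the `K`-th coordinate direction. -/
noncomputable def pd {n : ℕ} (K : Fin n) (f : (Fin n → ℝ) → ℝ) (x : Fin n → ℝ) : ℝ :=
  fderiv ℝ f x (Pi.single K 1)

/-- A smooth closed curve lying in `B`. -/
def IsSmoothClosedCurveIn {n : ℕ} (B : Set (Fin n → ℝ)) (γ : ℝ → Fin n → ℝ) : Prop :=
  ContDiff ℝ (⊤ : ℕ∞) γ ∧ (∀ t, γ (t + 1) = γ t) ∧ ∀ t, γ t ∈ B

section Primitive

open Set Filter Topology intervalIntegral

variable {E : Type*} [NormedAddCommGroup E] [NormedSpace ℝ E]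

/-- A smooth path lying in `B` which is constant, equal to `p`, for nonpositive times
and constant, equal to `q`, for times at least `1`. -/
structure IsFlatPath (B : Set E) (γ : ℝ → E) (p q : E) : Prop where
  contDiff : ContDiff ℝ (⊤ : ℕ∞) γ
  mem : ∀ t, γ t ∈ B
  source : ∀ t ≤ 0, γ t = p
  target : ∀ t, 1 ≤ t → γ t = q

/-- The integral of the 1-form `θ` along some flat path from `p` to `q` in `B` equals `c`. -/
def HasPathIntegral (B : Set E) (θ : E → E →L[ℝ] ℝ) (p q : E) (c : ℝ) : Prop :=
  ∃ γ : ℝ → E, IsFlatPath B γ p q ∧ ∫ t in (0:ℝ)..1, θ (γ t) (deriv γ t) = c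

variable {B : Set E} {θ : E → E →L[ℝ] ℝ} {p q r : E} {c d : ℝ} {γ δ : ℝ → E}

lemma ContDiff.hasDerivAt_deriv (h : ContDiff ℝ (⊤ : ℕ∞) γ) (t : ℝ) :
    HasDerivAt γ (deriv γ t) t :=
  ((h.differentiable (by simp)) t).hasDerivAt

lemma continuous_form_deriv (hθ : ContinuousOn θ B) (h : ContDiff ℝ (⊤ : ℕ∞) γ)
    (hB : ∀ t, γ t ∈ B) : Continuous fun t => θ (γ t) (deriv γ t) :=
  (hθ.comp_continuous h.continuous hB).clm_apply (h.continuous_deriv (by simp))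

lemma IsFlatPath.deriv_of_neg (h : IsFlatPath B γ p q) {t : ℝ} (ht : t < 0) :
    deriv γ t = 0 := by
  have : γ =ᶠ[𝓝 t] fun _ => p := by
    filter_upwards [Iio_mem_nhds ht] with s hs using h.source s (le_of_lt hs)
  rw [this.deriv_eq, deriv_const]

lemma IsFlatPath.deriv_of_one_lt (h : IsFlatPath B γ p q) {t : ℝ} (ht : 1 < t) :
    deriv γ t = 0 := by
  have : γ =ᶠ[𝓝 t] fun _ => q := by
    filter_upwards [Ioi_mem_nhds ht] with s hs using h.target s (le_of_lt hs)
  rw [this.deriv_eq, deriv_const]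

lemma HasPathIntegral.symm (h : HasPathIntegral B θ p q c) :
    HasPathIntegral B θ q p (-c) := by
  obtain ⟨γ, hγ, rfl⟩ := h
  refine ⟨fun t => γ (1 - t), ⟨hγ.contDiff.comp (by fun_prop), fun t => hγ.mem _,
    fun t ht => hγ.target _ (by linarith), fun t ht => hγ.source _ (by linarith)⟩, ?_⟩
  have hd : ∀ t, deriv (fun t => γ (1 - t)) t = -deriv γ (1 - t) := fun t =>
    deriv_comp_const_sub ..
  simp only [hd, map_neg, integral_neg]
  rw [integral_comp_sub_left (fun t => θ (γ t) (deriv γ t))]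
  simp

lemma HasPathIntegral.trans (hθ : ContinuousOn θ B) (h : HasPathIntegral B θ p q c)
    (h' : HasPathIntegral B θ q r d) : HasPathIntegral B θ p r (c + d) := by
  obtain ⟨γ, hγ, rfl⟩ := h
  obtain ⟨δ, hδ, rfl⟩ := h'
  set σ : ℝ → E := fun t => γ (2 * t) + δ (2 * t - 1) - q with hσ
  have hl : ∀ t, 2 * t ≤ 1 → σ t = γ (2 * t) := fun t ht => by
    simp [hσ, hδ.source (2 * t - 1) (by linarith)]
  have hr : ∀ t, 1 ≤ 2 * t → σ t = δ (2 * t - 1) := fun t ht => by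
    simp [hσ, hγ.target (2 * t) ht]
  have hsm : ContDiff ℝ (⊤ : ℕ∞) σ :=
    ((hγ.contDiff.comp (by fun_prop)).add (hδ.contDiff.comp (by fun_prop))).sub contDiff_const
  have hmem : ∀ t, σ t ∈ B := fun t => by
    rcases le_total (2 * t) 1 with ht | ht
    · rw [hl t ht]; exact hγ.mem _
    · rw [hr t ht]; exact hδ.mem _
  have hd : ∀ t, deriv σ t = (2:ℝ) • deriv γ (2 * t) + (2:ℝ) • deriv δ (2 * t - 1) := fun t => by
    have h1 : HasDerivAt (fun t : ℝ => 2 * t) 2 t := by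
      simpa using (hasDerivAt_id t).const_mul (2:ℝ)
    exact (((hγ.contDiff.hasDerivAt_deriv (2 * t)).scomp t h1).add
      ((hδ.contDiff.hasDerivAt_deriv (2 * t - 1)).scomp t (h1.sub_const 1))).sub_const q |>.deriv
  refine ⟨σ, ⟨hsm, hmem, fun t ht => ?_, fun t ht => ?_⟩, ?_⟩
  · rw [hl t (by linarith), hγ.source _ (by linarith)]
  · rw [hr t (by linarith), hδ.target _ (by linarith)]
  have hc := continuous_form_deriv hθ hsm hmem
  rw [← integral_add_adjacent_intervals (hc.intervalIntegrable 0 (1 / 2))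
    (hc.intervalIntegrable (1 / 2) 1)]
  congr 1
  · rw [integral_congr_Ioo_of_le (g := fun t => (2:ℝ) • θ (γ (2 * t)) (deriv γ (2 * t)))
      (by norm_num), integral_smul,
      smul_integral_comp_mul_left (fun t => θ (γ t) (deriv γ t))]
    · norm_num
    · intro t ht
      have ht2 : 2 * t - 1 < 0 := by linarith [ht.2]
      simp [hd, hl t (by linarith), hδ.deriv_of_neg ht2]
  · rw [integral_congr_Ioo_of_le
      (g := fun t => (2:ℝ) • θ (δ (2 * t - 1)) (deriv δ (2 * t - 1))) (by norm_num), integral_smul,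
      smul_integral_comp_mul_sub (fun t => θ (δ t) (deriv δ t))]
    · norm_num
    · intro t ht
      have ht2 : 1 < 2 * t := by linarith [ht.1]
      simp [hd, hr t ht2.le, hγ.deriv_of_one_lt ht2]

/-- A flat loop extends periodically to a smooth closed curve with the same integral. -/
lemma HasPathIntegral.exists_periodic (h : HasPathIntegral B θ p p c) :
    ∃ γ : ℝ → E, ContDiff ℝ (⊤ : ℕ∞) γ ∧ (∀ t, γ (t + 1) = γ t) ∧ (∀ t, γ t ∈ B) ∧
      ∫ t in (0:ℝ)..1, θ (γ t) (deriv γ t) = c := by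
  obtain ⟨γ, hγ, rfl⟩ := h
  have key : ∀ (n : ℤ) (t : ℝ), (n:ℝ) - 1 < t → t < n + 1 →
      γ (Int.fract t) = γ (t - n) + γ (t - n + 1) - p := by
    intro n t h1 h2
    rcases le_or_gt (n:ℝ) t with ht | ht
    · have hf : Int.floor t = n := Int.floor_eq_iff.2 ⟨ht, h2⟩
      rw [hγ.target (t - n + 1) (by linarith), Int.fract, hf]; simp
    · have hf : Int.floor t = n - 1 :=
        Int.floor_eq_iff.2 ⟨by push_cast; linarith, by push_cast; linarith⟩
      rw [hγ.source (t - n) (by linarith), Int.fract, hf]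
      simp [sub_sub_eq_add_sub, sub_add_eq_add_sub]
  refine ⟨fun t => γ (Int.fract t), ?_, fun t => by simp, fun t => hγ.mem _, ?_⟩
  · rw [contDiff_iff_contDiffAt]
    intro t
    have hs : ContDiff ℝ (⊤ : ℕ∞) fun s : ℝ =>
        γ (s - Int.floor t) + γ (s - Int.floor t + 1) - p :=
      ((hγ.contDiff.comp (by fun_prop)).add (hγ.contDiff.comp (by fun_prop))).sub contDiff_const
    refine hs.contDiffAt.congr_of_eventuallyEq ?_
    filter_upwards [Ioo_mem_nhds (show (Int.floor t : ℝ) - 1 < t by linarith [Int.floor_le t])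
      (Int.lt_floor_add_one t)] with s hs using key _ s hs.1 hs.2
  · refine integral_congr_Ioo_of_le zero_le_one fun t ht => ?_
    have : (fun t => γ (Int.fract t)) =ᶠ[𝓝 t] γ := by
      filter_upwards [Ioo_mem_nhds ht.1 ht.2] with s hs
      rw [Int.fract_eq_self.2 ⟨hs.1.le, hs.2⟩]
    simp only [this.deriv_eq]
    rw [Int.fract_eq_self.2 ⟨ht.1.le, ht.2⟩]

lemma hasPathIntegral_segment (hθ : ContinuousOn θ B) (h : segment ℝ p q ⊆ B) :
    HasPathIntegral B θ p q (curveIntegral θ (.segment p q)) := by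
  have hmem : ∀ t ∈ Icc (0:ℝ) 1, AffineMap.lineMap p q t ∈ B := fun t ht =>
    h (lineMap_mem_segment ℝ p q ht)
  have hs : ∀ t, Real.smoothTransition t ∈ Icc (0:ℝ) 1 := fun t =>
    ⟨Real.smoothTransition.nonneg t, Real.smoothTransition.le_one t⟩
  have hsd : ContDiff ℝ (⊤ : ℕ∞) Real.smoothTransition := Real.smoothTransition.contDiff
  have hd : ∀ t, deriv (fun t => AffineMap.lineMap p q (Real.smoothTransition t)) t =
      deriv Real.smoothTransition t • (q - p) := fun t =>
    (AffineMap.hasDerivAt_lineMap.scomp t (hsd.hasDerivAt_deriv t)).deriv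
  refine ⟨fun t => AffineMap.lineMap p q (Real.smoothTransition t), ⟨?_, fun t => hmem _ (hs t),
    fun t ht => ?_, fun t ht => ?_⟩, ?_⟩
  · simp only [AffineMap.lineMap_apply_module']
    fun_prop
  · simp [Real.smoothTransition.zero_of_nonpos ht]
  · simp [Real.smoothTransition.one_of_one_le ht]
  rw [curveIntegral_segment]
  have := integral_comp_mul_deriv' (a := 0) (b := 1) (f := Real.smoothTransition)
    (g := fun t => θ (AffineMap.lineMap p q t) (q - p))
    (fun t _ => hsd.hasDerivAt_deriv t) (hsd.continuous_deriv (by simp)).continuousOn ?_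
  · simp only [Real.smoothTransition.zero, Real.smoothTransition.one] at this
    rw [← this]
    refine integral_congr fun t _ => ?_
    simp [hd, mul_comm]
  · have : ContinuousOn (fun t => θ (AffineMap.lineMap p q t)) (Icc (0:ℝ) 1) :=
      hθ.comp AffineMap.lineMap_continuous.continuousOn hmem
    exact (this.clm_apply continuousOn_const).mono (image_subset_iff.2 fun t _ => hs t)

/-- A continuous 1-form whose integrals along smooth closed curves vanish has a primitive. -/
theorem exists_primitive_of_closed_curve_integral_eq_zero (hB : IsOpen B)
    (hθ : ContinuousOn θ B)
    (hloop : ∀ γ : ℝ → E, ContDiff ℝ (⊤ : ℕ∞) γ → (∀ t, γ (t + 1) = γ t) → (∀ t, γ t ∈ B) →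
      ∫ t in (0:ℝ)..1, θ (γ t) (deriv γ t) = 0) :
    ∃ f : E → ℝ, ∀ x ∈ B, HasFDerivAt f (θ x) x := by
  have huniq : ∀ {p q c d}, HasPathIntegral B θ p q c → HasPathIntegral B θ p q d → c = d := by
    intro p q c d h h'
    obtain ⟨γ, h1, h2, h3, h4⟩ := (h.trans hθ h'.symm).exists_periodic
    linarith [hloop γ h1 h2 h3]
  let S : Setoid B :=
    { r := fun p q => ∃ c, HasPathIntegral B θ p q c
      iseqv := ⟨fun p => ⟨_, hasPathIntegral_segment hθ (by simp)⟩,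
        fun ⟨_, h⟩ => ⟨_, h.symm⟩, fun ⟨_, h⟩ ⟨_, h'⟩ => ⟨_, h.trans hθ h'⟩⟩ }
  have hex : ∀ q : B, ∃ c, HasPathIntegral B θ (Quotient.mk S q).out q c := fun q =>
    Quotient.exact (Quotient.out_eq (Quotient.mk S q))
  choose g hg using hex
  classical
  refine ⟨fun x => if h : x ∈ B then g ⟨x, h⟩ else 0, fun x hx => ?_⟩
  obtain ⟨ε, hε, hball⟩ := Metric.isOpen_iff.1 hB x hx
  have hder : HasFDerivAt (fun y => g ⟨x, hx⟩ + curveIntegral θ (.segment x y)) (θ x) x := by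
    refine (HasFDerivAt.curveIntegral_segment_source' ?_).const_add _
    filter_upwards [hB.mem_nhds hx] with z hz using hθ.continuousAt (hB.mem_nhds hz)
  refine hder.congr_of_eventuallyEq ?_
  filter_upwards [Metric.ball_mem_nhds x hε] with y hy
  have hyB := hball hy
  have hseg : HasPathIntegral B θ x y (curveIntegral θ (.segment x y)) :=
    hasPathIntegral_segment hθ
      (((convex_ball x ε).segment_subset (Metric.mem_ball_self hε) hy).trans hball)
  have hq : Quotient.mk S ⟨x, hx⟩ = Quotient.mk S ⟨y, hyB⟩ := Quotient.sound ⟨_, hseg⟩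
  have h1 := (hg ⟨x, hx⟩).trans hθ hseg
  rw [hq] at h1
  simp only [hyB, dif_pos]
  exact huniq (hg ⟨y, hyB⟩) h1

/-- The integral of an exact 1-form along a smooth closed curve vanishes. -/
theorem closed_curve_integral_eq_zero_of_hasFDerivAt {f : E → ℝ} (hθ : ContinuousOn θ B)
    (hf : ∀ x ∈ B, HasFDerivAt f (θ x) x) (hγ : ContDiff ℝ (⊤ : ℕ∞) γ)
    (hper : ∀ t, γ (t + 1) = γ t) (hmem : ∀ t, γ t ∈ B) :
    ∫ t in (0:ℝ)..1, θ (γ t) (deriv γ t) = 0 := by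
  rw [integral_eq_sub_of_hasDerivAt (f := f ∘ γ)
    (fun t _ => (hf _ (hmem t)).comp_hasDerivAt t (hγ.hasDerivAt_deriv t))
    ((continuous_form_deriv hθ hγ hmem).intervalIntegrable _ _)]
  have := hper 0
  simp only [zero_add] at this
  simp [this]

end Primitive

section PartialDerivatives

open Topology

variable {n : ℕ} {B : Set (Fin n → ℝ)} {f g : (Fin n → ℝ) → ℝ} {x : Fin n → ℝ}

lemma fderiv_apply_eq_sum_pd (f : (Fin n → ℝ) → ℝ) (x v : Fin n → ℝ) :
    fderiv ℝ f x v = ∑ K, pd K f x * v K := by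
  conv_lhs => rw [← Finset.univ_sum_single v]
  rw [map_sum]
  refine Finset.sum_congr rfl fun K _ => ?_
  rw [pd, ← mul_one (v K), ← smul_eq_mul (v K) 1, Pi.single_smul, map_smul]
  simp [mul_comm]

lemma pd_congr (hB : IsOpen B) (h : ∀ y ∈ B, f y = g y) (hx : x ∈ B) (K : Fin n) :
    pd K f x = pd K g x := by
  have : f =ᶠ[𝓝 x] g := by filter_upwards [hB.mem_nhds hx] with y hy using h y hy
  rw [pd, pd, this.fderiv_eq]

lemma ContDiffOn.differentiableAt_of_isOpen (hf : ContDiffOn ℝ (⊤ : ℕ∞) f B) (hB : IsOpen B)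
    (hx : x ∈ B) : DifferentiableAt ℝ f x :=
  (hf.contDiffAt (hB.mem_nhds hx)).differentiableAt (by simp)

lemma ContDiffOn.pd (hf : ContDiffOn ℝ (⊤ : ℕ∞) f B) (hB : IsOpen B) (K : Fin n) :
    ContDiffOn ℝ (⊤ : ℕ∞) (pd K f) B :=
  ((contDiffOn_infty_iff_fderiv_of_isOpen hB).1 hf).2.clm_apply contDiffOn_const

lemma pd_add (hf : DifferentiableAt ℝ f x) (hg : DifferentiableAt ℝ g x) (K : Fin n) :
    pd K (fun y => f y + g y) x = pd K f x + pd K g x := by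
  simp [pd, fderiv_fun_add hf hg]

lemma pd_sub (hf : DifferentiableAt ℝ f x) (hg : DifferentiableAt ℝ g x) (K : Fin n) :
    pd K (fun y => f y - g y) x = pd K f x - pd K g x := by
  simp [pd, fderiv_fun_sub hf hg]

lemma pd_div_const (f : (Fin n → ℝ) → ℝ) (c : ℝ) (K : Fin n) :
    pd K (fun y => f y / c) x = pd K f x / c := by
  have : (fun y => f y / c) = c⁻¹ • f := by ext y; simp [div_eq_inv_mul]
  rw [pd, pd, this, fderiv_const_smul_field]
  simp [div_eq_inv_mul]

lemma pd_sum_coord_mul {w : Fin n → (Fin n → ℝ) → ℝ} (hw : ∀ L, DifferentiableAt ℝ (w L) x)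
    (K : Fin n) :
    pd K (fun y => ∑ L, y L * w L y) x = w K x + ∑ L, x L * pd K (w L) x := by
  have h : HasFDerivAt (fun y => ∑ L, y L * w L y)
      (∑ L, (x L • fderiv ℝ (w L) x + w L x • ContinuousLinearMap.proj (R := ℝ) L)) x :=
    HasFDerivAt.fun_sum fun L _ => (hasFDerivAt_apply L x).mul (hw L).hasFDerivAt
  rw [pd, h.fderiv]
  simp [pd, Finset.sum_add_distrib, Pi.single_apply, add_comm]

lemma pd_comm (hf : ContDiffOn ℝ (⊤ : ℕ∞) f B) (hB : IsOpen B) (hx : x ∈ B) (I J : Fin n) :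
    pd I (pd J f) x = pd J (pd I f) x := by
  have hd : DifferentiableAt ℝ (fderiv ℝ f) x :=
    ((((contDiffOn_infty_iff_fderiv_of_isOpen hB).1 hf).2).contDiffAt
      (hB.mem_nhds hx)).differentiableAt (by simp)
  have hc : ∀ I J : Fin n, pd I (pd J f) x =
      fderiv ℝ (fderiv ℝ f) x (Pi.single I 1) (Pi.single J 1) := fun I J => by
    have : HasFDerivAt (pd J f) _ x :=
      hd.hasFDerivAt.clm_apply (hasFDerivAt_const (Pi.single J 1 : Fin n → ℝ) x)
    rw [pd, this.fderiv]
    simp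
  rw [hc, hc]
  exact (hf.contDiffAt (hB.mem_nhds hx)).isSymmSndFDerivAt
    (by simpa using WithTop.coe_le_coe.2 (le_top : (2 : ℕ∞) ≤ ⊤)) _ _

/-- Smooth functions `a K` on `B` are the partial derivatives of a smooth function as soon as the
line integrals of the corresponding 1-form along smooth closed curves vanish. -/
theorem exists_potential_of_closed_curve_integral_eq_zero (hB : IsOpen B)
    {a : Fin n → (Fin n → ℝ) → ℝ} (ha : ∀ K, ContDiffOn ℝ (⊤ : ℕ∞) (a K) B)
    (hloop : ∀ γ : ℝ → Fin n → ℝ, IsSmoothClosedCurveIn B γ →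
      ∫ t in (0:ℝ)..1, ∑ K, a K (γ t) * deriv γ t K = 0) :
    ∃ f, ContDiffOn ℝ (⊤ : ℕ∞) f B ∧ ∀ x ∈ B, ∀ K, pd K f x = a K x := by
  set θ : (Fin n → ℝ) → (Fin n → ℝ) →L[ℝ] ℝ :=
    fun x => ∑ K, a K x • ContinuousLinearMap.proj (R := ℝ) K with hθ
  have hθs : ContDiffOn ℝ (⊤ : ℕ∞) θ B :=
    ContDiffOn.sum fun K _ => (ha K).smul contDiffOn_const
  obtain ⟨f, hf⟩ := exists_primitive_of_closed_curve_integral_eq_zero hB hθs.continuousOn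
    fun γ h1 h2 h3 => by simpa [hθ] using hloop γ ⟨h1, h2, h3⟩
  refine ⟨f, (contDiffOn_infty_iff_fderiv_of_isOpen hB).2
    ⟨fun x hx => (hf x hx).differentiableAt.differentiableWithinAt,
      hθs.congr fun x hx => (hf x hx).fderiv⟩, fun x hx K => ?_⟩
  rw [pd, (hf x hx).fderiv]
  simp [hθ, Pi.single_apply]

theorem closed_curve_integral_eq_zero_of_pd_eq (hB : IsOpen B)
    (hf : ContDiffOn ℝ (⊤ : ℕ∞) f B) {a : Fin n → (Fin n → ℝ) → ℝ}
    (ha : ∀ x ∈ B, ∀ K, pd K f x = a K x) {γ : ℝ → Fin n → ℝ}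
    (hγ : IsSmoothClosedCurveIn B γ) :
    ∫ t in (0:ℝ)..1, ∑ K, a K (γ t) * deriv γ t K = 0 := by
  have h := closed_curve_integral_eq_zero_of_hasFDerivAt
    ((contDiffOn_infty_iff_fderiv_of_isOpen hB).1 hf).2.continuousOn
    (fun x hx => (hf.differentiableAt_of_isOpen hB hx).hasFDerivAt) hγ.1 hγ.2.1 hγ.2.2
  simpa only [fderiv_apply_eq_sum_pd, ha _ (hγ.2.2 _)] using h

end PartialDerivatives

section SymmetrizedGradient

variable {n : ℕ} {B : Set (Fin n → ℝ)} {T : (Fin n → ℝ) → Fin n → Fin n → ℝ}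

lemma pd_antisymmetrized_gradient (hB : IsOpen B) {Y : (Fin n → ℝ) → Fin n → ℝ}
    (hY : ∀ I, ContDiffOn ℝ (⊤ : ℕ∞) (fun y => Y y I) B)
    (hTY : ∀ x ∈ B, ∀ I J,
      T x I J = (pd J (fun y => Y y I) x + pd I (fun y => Y y J) x) / 2)
    {x : Fin n → ℝ} (hx : x ∈ B) (I J K : Fin n) :
    pd K (fun y => (pd J (fun y => Y y I) y - pd I (fun y => Y y J) y) / 2) x =
      pd J (fun y => T y I K) x - pd I (fun y => T y J K) x := by
  have hd : ∀ I J, DifferentiableAt ℝ (pd J fun y => Y y I) x := fun I J =>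
    ((hY I).pd hB J).differentiableAt_of_isOpen hB hx
  rw [pd_congr hB (fun y hy => hTY y hy I K) hx, pd_congr hB (fun y hy => hTY y hy J K) hx,
    pd_div_const, pd_div_const, pd_div_const, pd_sub (hd _ _) (hd _ _),
    pd_add (hd _ _) (hd _ _), pd_add (hd _ _) (hd _ _), pd_comm (hY I) hB hx K J,
    pd_comm (hY J) hB hx K I, pd_comm (hY K) hB hx I J]
  ring

/-- The gradient of `x^K W^{IK}`, where `W^{IJ}` has gradient `∂_J T^{IK} - ∂_I T^{JK}`. -/
lemma pd_sum_coord_mul_antisymmetrized_gradient (hB : IsOpen B)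
    (hsym : ∀ x ∈ B, ∀ I J, T x I J = T x J I)
    {W : Fin n → Fin n → (Fin n → ℝ) → ℝ} {x : Fin n → ℝ} (hx : x ∈ B)
    (hW : ∀ I J, DifferentiableAt ℝ (W I J) x)
    (hpW : ∀ I J K, pd K (W I J) x = pd J (fun y => T y I K) x - pd I (fun y => T y J K) x)
    (I J : Fin n) :
    pd J (fun y => ∑ K, y K * W I K y) x = W I J x + ∑ K, x K *
      (pd K (fun y => T y I J) x - pd I (fun y => T y J K) x) := by
  rw [pd_sum_coord_mul (hW I)]
  simp only [hpW, pd_congr hB (fun y hy => hsym y hy J _) hx]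

end SymmetrizedGradient

/-- A smooth symmetric (²₀)-tensor field `T` on an open set `B ⊆ ℝ²` is a symmetrized
gradient `grad^s Y` iff `D_c T = ∂₂∂₂T^{11} − 2∂₁∂₂T^{12} + ∂₁∂₁T^{22} = 0` and the two
families of line integrals over all smooth closed curves in `B` vanish.
(Indices `1,2` are `0,1 : Fin 2`.) -/
theorem symmetrized_gradient_potential_iff_2d
    (B : Set (Fin 2 → ℝ)) (hB : IsOpen B)
    (T : (Fin 2 → ℝ) → Fin 2 → Fin 2 → ℝ)
    (hT : ContDiffOn ℝ (⊤ : ℕ∞) T B)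
    (hsym : ∀ x ∈ B, ∀ I J, T x I J = T x J I) :
    (∃ Y : (Fin 2 → ℝ) → Fin 2 → ℝ,
        ContDiffOn ℝ (⊤ : ℕ∞) Y B ∧
        ∀ x ∈ B, ∀ I J,
          T x I J = (pd J (fun y => Y y I) x + pd I (fun y => Y y J) x) / 2) ↔
      ((∀ x ∈ B,
          pd 1 (fun y => pd 1 (fun z => T z 0 0) y) x -
            2 * pd 0 (fun y => pd 1 (fun z => T z 0 1) y) x +
            pd 0 (fun y => pd 0 (fun z => T z 1 1) y) x = 0) ∧
        (∀ γ : ℝ → Fin 2 → ℝ, IsSmoothClosedCurveIn B γ →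
          ∀ I, (∫ t in (0:ℝ)..1, ∑ J,
            (T (γ t) I J - ∑ K, γ t K *
              (pd K (fun y => T y I J) (γ t) - pd I (fun y => T y J K) (γ t))) *
              deriv γ t J) = 0) ∧
        (∀ γ : ℝ → Fin 2 → ℝ, IsSmoothClosedCurveIn B γ →
          ∀ I J, (∫ t in (0:ℝ)..1, ∑ K,
            (pd J (fun y => T y I K) (γ t) - pd I (fun y => T y J K) (γ t)) *
              deriv γ t K) = 0)) := by
  have hTs : ∀ I J, ContDiffOn ℝ (⊤ : ℕ∞) (fun y => T y I J) B := fun I J =>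
    contDiffOn_pi.1 (contDiffOn_pi.1 hT I) J
  constructor
  · rintro ⟨Y, hY, hTY⟩
    rw [contDiffOn_pi] at hY
    have hYd := fun I J => (hY I).pd hB J
    set W : Fin 2 → Fin 2 → (Fin 2 → ℝ) → ℝ :=
      fun I J y => (pd J (fun y => Y y I) y - pd I (fun y => Y y J) y) / 2 with hW
    have hWs : ∀ I J, ContDiffOn ℝ (⊤ : ℕ∞) (W I J) B := fun I J =>
      ((hYd I J).sub (hYd J I)).div_const 2
    have hpW : ∀ x ∈ B, ∀ I J K, pd K (W I J) x =
        pd J (fun y => T y I K) x - pd I (fun y => T y J K) x := fun x hx I J K =>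
      pd_antisymmetrized_gradient hB hY hTY hx I J K
    refine ⟨fun x hx => ?_, fun γ hγ I => ?_, fun γ hγ I J => ?_⟩
    · have hTd := fun I J K =>
        ((hTs I J).pd hB K).differentiableAt_of_isOpen hB hx
      have h := pd_comm (hWs 0 1) hB hx 0 1
      rw [pd_congr hB (fun y hy => hpW y hy 0 1 1) hx,
        pd_congr hB (fun y hy => hpW y hy 0 1 0) hx, pd_sub (hTd _ _ _) (hTd _ _ _),
        pd_sub (hTd _ _ _) (hTd _ _ _),
        pd_congr hB (fun y hy => pd_congr hB (fun z hz => hsym z hz 1 0) hy 0) hx 1,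
        pd_comm (hTs 0 1) hB hx 1 0] at h
      linarith
    · have hs : ContDiffOn ℝ (⊤ : ℕ∞) (fun y => ∑ K, y K * W I K y) B :=
        ContDiffOn.sum fun K _ => (contDiff_apply ℝ ℝ K).contDiffOn.mul (hWs I K)
      refine closed_curve_integral_eq_zero_of_pd_eq hB ((hY I).sub hs)
        (a := fun J x => T x I J - ∑ K, x K *
          (pd K (fun y => T y I J) x - pd I (fun y => T y J K) x)) (fun x hx J => ?_) hγ
      rw [pd_sub ((hY I).differentiableAt_of_isOpen hB hx) (hs.differentiableAt_of_isOpen hB hx),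
        pd_sum_coord_mul_antisymmetrized_gradient hB hsym hx
          (fun I J => (hWs I J).differentiableAt_of_isOpen hB hx) (hpW x hx), hTY x hx, hW]
      ring
    · exact closed_curve_integral_eq_zero_of_pd_eq hB (hWs I J)
        (fun x hx K => hpW x hx I J K) hγ
  · rintro ⟨-, hg, hw⟩
    obtain ⟨w, hws, hpw⟩ := exists_potential_of_closed_curve_integral_eq_zero hB
      (fun K => ((hTs 0 K).pd hB 1).sub ((hTs 1 K).pd hB 0)) fun γ hγ => hw γ hγ 0 1
    have hgs : ∀ I J, ContDiffOn ℝ (⊤ : ℕ∞) (fun x => T x I J - ∑ K, x K *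
        (pd K (fun y => T y I J) x - pd I (fun y => T y J K) x)) B := fun I J =>
      (hTs I J).sub (ContDiffOn.sum fun K _ => (contDiff_apply ℝ ℝ K).contDiffOn.mul
        (((hTs I J).pd hB K).sub ((hTs J K).pd hB I)))
    choose g hgs' hpg using fun I => exists_potential_of_closed_curve_integral_eq_zero hB
      (hgs I) fun γ hγ => hg γ hγ I
    set W : Fin 2 → Fin 2 → (Fin 2 → ℝ) → ℝ :=
      ![![fun _ => 0, w], ![fun y => 0 - w y, fun _ => 0]] with hW
    have hWs : ∀ I J, ContDiffOn ℝ (⊤ : ℕ∞) (W I J) B := by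
      simp only [Fin.forall_fin_two]
      exact ⟨⟨contDiffOn_const, hws⟩, contDiffOn_const.sub hws, contDiffOn_const⟩
    have hanti : ∀ x I J, W I J x + W J I x = 0 := by
      simp [Fin.forall_fin_two, hW]
    have hpW : ∀ x ∈ B, ∀ I J K, pd K (W I J) x =
        pd J (fun y => T y I K) x - pd I (fun y => T y J K) x := by
      intro x hx I J K
      have h0 : pd K (fun _ => (0:ℝ)) x = 0 := by simp [pd]
      revert I J
      simp only [Fin.forall_fin_two]
      refine ⟨⟨h0.trans (sub_self _).symm, hpw x hx K⟩, ?_, h0.trans (sub_self _).symm⟩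
      refine (pd_sub (differentiableAt_const _) (hws.differentiableAt_of_isOpen hB hx) K).trans ?_
      rw [h0, hpw x hx K]
      simp
    have hs : ∀ I, ContDiffOn ℝ (⊤ : ℕ∞) (fun y => ∑ K, y K * W I K y) B := fun I =>
      ContDiffOn.sum fun K _ => (contDiff_apply ℝ ℝ K).contDiffOn.mul (hWs I K)
    have hpY : ∀ x ∈ B, ∀ I J, pd J (fun y => g I y + ∑ K, y K * W I K y) x =
        T x I J + W I J x := by
      intro x hx I J
      rw [pd_add ((hgs' I).differentiableAt_of_isOpen hB hx)
        ((hs I).differentiableAt_of_isOpen hB hx), hpg I x hx,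
        pd_sum_coord_mul_antisymmetrized_gradient hB hsym hx
          (fun I J => (hWs I J).differentiableAt_of_isOpen hB hx) (hpW x hx)]
      ring
    refine ⟨fun y I => g I y + ∑ K, y K * W I K y,
      contDiffOn_pi.2 fun I => (hgs' I).add (hs I), fun x hx I J => ?_⟩
    rw [hpY x hx, hpY x hx, hsym x hx J I]
    linarith [hanti x I J]
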